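/- Let the standing assumptions hold. Then for every x₀ ∈ dom Φ there exists an absolutely continuous function x : [0,∞) → ℝ^d with locally integrable derivative u such that x(0) = x₀, x(t) ∈ dom Φ for all t ≥ 0, and u(t) ∈ −D_Φ(x(t)) for almost every t > 0; i.e., solutions of the differential inclusion x' ∈ −D_Φ(x) exist globally on [0,∞) from every initial point of dom Φ. -/

import Mathlib

open scoped RealInnerProductSpace
open MeasureTheory

noncomputable section

/-- Euclidean space ℝ^d. -/
abbrev Euc (d : ℕ) := EuclideanSpace ℝ (Fin d)

/-- Convex subdifferential of an extended-real-valued function. -/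
def Subdiff {d : ℕ} (g : Euc d → EReal) (x : Euc d) : Set (Euc d) :=
  {v | ∀ y : Euc d, g x + ((⟪v, y - x⟫ : ℝ) : EReal) ≤ g y}

/-- Proper: somewhere finite and never −∞. -/
def ProperFn {d : ℕ} (g : Euc d → EReal) : Prop :=
  (∃ x, g x ≠ ⊤) ∧ ∀ x, g x ≠ ⊥

/-- Convexity via the epigraph. -/
def ConvexFn {d : ℕ} (g : Euc d → EReal) : Prop :=
  Convex ℝ {p : Euc d × ℝ | g p.1 ≤ (p.2 : EReal)}

/-- Locally Lipschitz on the domain `{x | g x ≠ ⊤}`. -/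
def LocLipOnDom {d : ℕ} (g : Euc d → EReal) : Prop :=
  ∀ x : Euc d, g x ≠ ⊤ → ∃ ε > (0:ℝ), ∃ K : ℝ, ∀ y : Euc d, g y ≠ ⊤ → ∀ z : Euc d, g z ≠ ⊤ →
    ‖y - x‖ ≤ ε → ‖z - x‖ ≤ ε → |(g y).toReal - (g z).toReal| ≤ K * ‖y - z‖

/-- A set-valued map is locally bounded. -/
def LocBounded {d : ℕ} (F : Euc d → Set (Euc d)) : Prop :=
  ∀ x : Euc d, ∃ ε > (0:ℝ), Bornology.IsBounded (⋃ y ∈ Metric.ball x ε, F y)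

/-- `D` is a conservative field for the locally Lipschitz function `f : ℝ^d → ℝ`. -/
def IsConservativeFieldR {d : ℕ} (D : Euc d → Set (Euc d)) (f : Euc d → ℝ) : Prop :=
  IsClosed {p : Euc d × Euc d | p.2 ∈ D p.1} ∧
  ∀ x u : ℝ → Euc d, IntervalIntegrable u volume 0 1 →
    (∀ t ∈ Set.Icc (0:ℝ) 1, x t = x 0 + ∫ s in (0:ℝ)..t, u s) →
    (∀ t ∈ Set.Icc (0:ℝ) 1, (D (x t)).Nonempty) →
    ∀ᵐ t ∂volume, t ∈ Set.Ioo (0:ℝ) 1 →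
      ∀ v ∈ D (x t), HasDerivAt (fun s => f (x s)) (⟪v, u t⟫ : ℝ) t

/-- The objective `Φ = f₁ + ⋯ + f_N + g`. -/
def Phi {d : ℕ} (N : ℕ) (f : Fin N → Euc d → ℝ) (g : Euc d → EReal) (x : Euc d) : EReal :=
  ((∑ i, f i x : ℝ) : EReal) + g x

/-- The field `D_Φ = D₁ + ⋯ + D_N + ∂g` (pointwise Minkowski sum). -/
def DPhi {d : ℕ} (N : ℕ) (D : Fin N → Euc d → Set (Euc d)) (g : Euc d → EReal)
    (x : Euc d) : Set (Euc d) :=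
  {w : Euc d | ∃ v : Fin N → Euc d, (∀ i, v i ∈ D i x) ∧
    ∃ s ∈ Subdiff g x, w = (∑ i, v i) + s}

/-- `(α, x)` is a proximal random reshuffling sequence: at each outer iteration `k`
there are a permutation `σ` and inner iterates `z` performing one subgradient step
for each `D_{σ(i)}` followed by a proximal step for `g`
(`x (k+1)` minimizes `w ↦ g w + ‖w − z_N‖²/(2 α_k)`). -/
def IsPRR {d : ℕ} (N : ℕ) (D : Fin N → Euc d → Set (Euc d)) (g : Euc d → EReal)
    (α : ℕ → ℝ) (x : ℕ → Euc d) : Prop :=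
  ∀ k : ℕ, ∃ (σ : Equiv.Perm (Fin N)) (z : ℕ → Euc d),
    z 0 = x k ∧
    (∀ i : Fin N, ∃ v ∈ D (σ i) (z i.1), z (i.1 + 1) = z i.1 - α k • v) ∧
    (∀ w : Euc d,
      g (x (k+1)) + ((‖x (k+1) - z N‖ ^ 2 / (2 * α k) : ℝ) : EReal) ≤
        g w + ((‖w - z N‖ ^ 2 / (2 * α k) : ℝ) : EReal))

/-- Standing assumptions of the paper: each `f_i` is locally Lipschitz, each `D_i`
is a locally bounded conservative field for `f_i` with nonempty convex values,
`g` is proper, convex, with closed domain and locally Lipschitz on its domain,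
and `Φ = f₁ + ⋯ + f_N + g` is bounded below. -/
def StandingAssumptions {d : ℕ} (N : ℕ) (f : Fin N → Euc d → ℝ)
    (D : Fin N → Euc d → Set (Euc d)) (g : Euc d → EReal) : Prop :=
  (∀ i, LocallyLipschitz (f i)) ∧
  (∀ i, IsConservativeFieldR (D i) (f i)) ∧
  (∀ i, LocBounded (D i)) ∧
  (∀ i x, (D i x).Nonempty ∧ Convex ℝ (D i x)) ∧
  ProperFn g ∧ ConvexFn g ∧ IsClosed {x : Euc d | g x ≠ ⊤} ∧ LocLipOnDom g ∧
  ∃ c : ℝ, ∀ x : Euc d, (c : EReal) ≤ Phi N f g x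

open Filter Topology

/-- `s` is a subgradient at `x` of `G` plus the indicator of `C`. -/
def IsSubgradOn {E : Type*} [NormedAddCommGroup E] [InnerProductSpace ℝ E]
    (C : Set E) (G : E → ℝ) (x s : E) : Prop :=
  ∀ y ∈ C, G x + ⟪s, y - x⟫ ≤ G y

/-- First-order optimality condition for a proximal step. -/
lemma isSubgradOn_of_isMinOn {E : Type*} [NormedAddCommGroup E] [InnerProductSpace ℝ E]
    {C : Set E} {G : E → ℝ} (hG : ConvexOn ℝ C G) {α : ℝ} (hα : 0 < α)
    {q b : E} (hq : q ∈ C) (hmin : IsMinOn (fun w => G w + ‖w - b‖ ^ 2 / (2 * α)) C q) :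
    IsSubgradOn C G q (α⁻¹ • (b - q)) := by
  intro y hy
  have key : ∀ l : ℝ, 0 < l → l ≤ 1 →
      ⟪α⁻¹ • (b - q), y - q⟫ - (G y - G q) ≤ l * (‖y - q‖ ^ 2 / (2 * α)) := by
    intro l hl hl1
    have hw : (1 - l) • q + l • y ∈ C := hG.1 hq hy (by linarith) hl.le (by ring)
    have h1 := hG.2 hq hy (by linarith : 0 ≤ 1 - l) hl.le (by ring)
    have h2 := isMinOn_iff.1 hmin _ hw
    have e : (1 - l) • q + l • y - b = (q - b) + l • (y - q) := by module
    have h3 : ‖(1 - l) • q + l • y - b‖ ^ 2 =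
        ‖q - b‖ ^ 2 + 2 * l * ⟪q - b, y - q⟫ + l ^ 2 * ‖y - q‖ ^ 2 := by
      rw [e, norm_add_sq_real, real_inner_smul_right, norm_smul, mul_pow, Real.norm_eq_abs, sq_abs]
      ring
    have h4 : ⟪α⁻¹ • (b - q), y - q⟫ = - (⟪q - b, y - q⟫ / α) := by
      rw [real_inner_smul_left, ← neg_sub q b, inner_neg_left]; field_simp
    simp only [smul_eq_mul] at h1
    rw [h3] at h2
    rw [h4]
    have h5 : (‖q - b‖ ^ 2 + 2 * l * ⟪q - b, y - q⟫ + l ^ 2 * ‖y - q‖ ^ 2) / (2 * α)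
        = ‖q - b‖ ^ 2 / (2 * α) + l * (⟪q - b, y - q⟫ / α + l * (‖y - q‖ ^ 2 / (2 * α))) := by
      field_simp
      ring
    rw [h5] at h2
    have h6 : 0 ≤ l * ((G y - G q) + ⟪q - b, y - q⟫ / α + l * (‖y - q‖ ^ 2 / (2 * α))) := by
      linarith
    have h7 := nonneg_of_mul_nonneg_right h6 hl
    linarith
  have hlim : Tendsto (fun l : ℝ => l * (‖y - q‖ ^ 2 / (2 * α))) (𝓝[>] 0) (𝓝 0) := by
    have : Tendsto (fun l : ℝ => l * (‖y - q‖ ^ 2 / (2 * α))) (𝓝 0)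
        (𝓝 (0 * (‖y - q‖ ^ 2 / (2 * α)))) := (continuous_id.mul continuous_const).tendsto 0
    rw [zero_mul] at this
    exact this.mono_left nhdsWithin_le_nhds
  have := ge_of_tendsto hlim (b := ⟪α⁻¹ • (b - q), y - q⟫ - (G y - G q)) (by
    filter_upwards [Ioc_mem_nhdsGT (zero_lt_one' ℝ)] with l hl using key l hl.1 hl.2)
  linarith

/-- One explicit step along `v` followed by a proximal step for `G` on `C`. -/
lemma exists_prox_step {E : Type*} [NormedAddCommGroup E] [InnerProductSpace ℝ E]
    {C : Set E} (hC : IsCompact C) {G : E → ℝ} (hG : ConvexOn ℝ C G)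
    {K M : ℝ} (hK : 0 ≤ K) (hGK : ∀ y ∈ C, ∀ z ∈ C, |G y - G z| ≤ K * ‖y - z‖)
    {v p : E} (hp : p ∈ C) (hv : ‖v‖ ≤ M) {α : ℝ} (hα : 0 < α) :
    ∃ q ∈ C, ∃ s, IsSubgradOn C G q s ∧ ‖s‖ ≤ K + 2 * M ∧ ‖v + s‖ ≤ K + M ∧
      q = p - α • (v + s) := by
  have hcG : ContinuousOn G C :=
    (LipschitzOnWith.of_dist_le_mul (K := K.toNNReal) fun y hy z hz => by
      rw [Real.dist_eq, dist_eq_norm]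
      exact (hGK y hy z hz).trans (by gcongr; exact Real.le_coe_toNNReal K)).continuousOn
  have hc : ContinuousOn (fun w => G w + ‖w - (p - α • v)‖ ^ 2 / (2 * α)) C :=
    hcG.add (by fun_prop)
  obtain ⟨q, hq, hmin⟩ := hC.exists_isMinOn ⟨p, hp⟩ hc
  have hs := isSubgradOn_of_isMinOn hG hα hq hmin
  set s := α⁻¹ • (p - α • v - q) with hsdef
  have hpq : p - q = α • (v + s) := by
    rw [hsdef, smul_add, smul_inv_smul₀ hα.ne']; abel
  have hvs : ‖v + s‖ ≤ K + M := by
    have h1 := hs p hp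
    have h2 := (abs_le.1 (hGK p hp q hq)).2
    rw [hpq, real_inner_smul_right] at h1
    rw [hpq, norm_smul, Real.norm_of_nonneg hα.le] at h2
    have h3 : α * ⟪s, v + s⟫ ≤ α * (K * ‖v + s‖) := by linarith
    have h4 := le_of_mul_le_mul_left h3 hα
    have h5 : ⟪v, v + s⟫ ≤ M * ‖v + s‖ :=
      (real_inner_le_norm _ _).trans (by gcongr)
    have h6 : ‖v + s‖ * ‖v + s‖ = ⟪v, v + s⟫ + ⟪s, v + s⟫ := by
      rw [← inner_add_left, real_inner_self_eq_norm_mul_norm]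
    by_contra hcon
    push Not at hcon
    have hM : 0 ≤ M := (norm_nonneg v).trans hv
    nlinarith
  refine ⟨q, hq, s, hs, ?_, hvs, by rw [← hpq]; abel⟩
  calc ‖s‖ = ‖(v + s) - v‖ := by congr 1; abel
    _ ≤ ‖v + s‖ + ‖v‖ := norm_sub_le _ _
    _ ≤ K + 2 * M := by linarith

lemma norm_sub_le_mul_of_norm_succ_sub_le {F : Type*} [SeminormedAddCommGroup F] {X : ℕ → F} {c : ℝ}
    (h : ∀ k, ‖X (k + 1) - X k‖ ≤ c) {i j : ℕ} (hij : i ≤ j) :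
    ‖X j - X i‖ ≤ c * ((j : ℝ) - i) := by
  induction j, hij using Nat.le_induction with
  | base => simp
  | succ j hij ih =>
    have : X (j + 1) - X i = (X (j + 1) - X j) + (X j - X i) := by abel
    rw [this]
    push_cast
    linarith [norm_add_le (X (j + 1) - X j) (X j - X i), h j]

lemma dist_le_mul_of_norm_succ_sub_le {F : Type*} [SeminormedAddCommGroup F] {X : ℕ → F} {c : ℝ}
    (h : ∀ k, ‖X (k + 1) - X k‖ ≤ c) (i j : ℕ) :
    dist (X i) (X j) ≤ c * |(i : ℝ) - j| := by
  rcases le_total i j with hij | hij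
  · rw [dist_eq_norm, norm_sub_rev, abs_sub_comm, abs_of_nonneg (by simpa using hij)]
    exact norm_sub_le_mul_of_norm_succ_sub_le h hij
  · rw [dist_eq_norm, abs_of_nonneg (by simpa using hij)]
    exact norm_sub_le_mul_of_norm_succ_sub_le h hij

lemma mul_le_sub_of_le_succ_sub {a : ℕ → ℝ} {c : ℝ} {i j : ℕ} (hij : i ≤ j)
    (h : ∀ k, i ≤ k → k < j → c ≤ a (k + 1) - a k) :
    c * ((j : ℝ) - i) ≤ a j - a i := by
  induction j, hij using Nat.le_induction with
  | base => simp
  | succ j hij ih =>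
    have h1 := ih fun k hk hkj => h k hk (by omega)
    have h2 := h j hij (by omega)
    push_cast
    linarith

/-- Compactness turns a strict bound on the fibre of `Γ` over the diagonal point `(x, x)` into the
same bound on all fibres over nearby points. -/
lemma exists_forall_dist_lt_of_fibre_lt {F : Type*} [MetricSpace F] {Γ : Set (F × F × F)}
    (hΓ : IsCompact Γ) {x : F}
    {φ : F → ℝ} (hφ : Continuous φ) {c : ℝ} (h : ∀ w, (x, x, w) ∈ Γ → φ w < c) :
    ∃ δ > 0, ∀ y z w, (y, z, w) ∈ Γ → dist y x < δ → dist z x < δ → φ w < c := by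
  have hS : IsCompact (Γ ∩ {p : F × F × F | c ≤ φ p.2.2}) :=
    hΓ.inter_right (isClosed_le continuous_const (by fun_prop))
  have hpos : ∀ p ∈ Γ ∩ {p : F × F × F | c ≤ φ p.2.2}, 0 < dist p.1 x + dist p.2.1 x := by
    rintro ⟨y, z, w⟩ ⟨hp, hc⟩
    by_contra hcon
    have hy : y = x := dist_le_zero.1 (by
      have := dist_nonneg (x := z) (y := x); simp only at hcon; linarith)
    have hz : z = x := dist_le_zero.1 (by
      have := dist_nonneg (x := y) (y := x); simp only at hcon; linarith)
    subst hy; subst hz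
    exact absurd (h w hp) (not_lt.2 hc)
  obtain ⟨ε, hε, hmin⟩ := hS.exists_forall_le'
    (f := fun p : F × F × F => dist p.1 x + dist p.2.1 x)
    (by fun_prop) hpos
  refine ⟨ε / 2, by positivity, fun y z w hp hy hz => ?_⟩
  by_contra hcon
  have := hmin (y, z, w) ⟨hp, not_lt.1 hcon⟩
  simp only at this
  linarith

lemma tendsto_natFloor_mul_succ_div (t : ℝ) (ht : 0 ≤ t) :
    Tendsto (fun n : ℕ => ((n : ℝ) + 1)⁻¹ * (⌊t * ((n : ℝ) + 1)⌋₊ : ℝ)) atTop (𝓝 t) := by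
  have h1 : Tendsto (fun n : ℕ => (n : ℝ) + 1) atTop atTop :=
    tendsto_atTop_add_const_right _ _ tendsto_natCast_atTop_atTop
  refine ((tendsto_nat_floor_mul_div_atTop ht).comp h1).congr fun n => ?_
  simp [div_eq_inv_mul]

/-- Limits of one-step schemes with vanishing step size: if from every point of `C` and for every
step size `α` there is a step `q = p - α • w` with `(p, q, w)` in a compact set `Γ` whose
diagonal fibres are convex, then the differential inclusion `-x' ∈ Γ (x, x)` has a Lipschitz
solution in `C`. -/
theorem exists_lipschitz_solution_of_steps {E : Type*} [NormedAddCommGroup E] [NormedSpace ℝ E]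
    {C : Set E} (hC : IsCompact C) {Γ : Set (E × E × E)}
    (hΓ : IsCompact Γ) (hconv : ∀ x ∈ C, Convex ℝ {w | (x, x, w) ∈ Γ})
    (hstep : ∀ α : ℝ, 0 < α → ∀ p ∈ C, ∃ q ∈ C, ∃ w, (p, q, w) ∈ Γ ∧ q = p - α • w)
    {x₀ : E} (hx₀ : x₀ ∈ C) :
    ∃ (B : NNReal) (x : ℝ → E), LipschitzWith B x ∧ x 0 = x₀ ∧ (∀ t, x t ∈ C) ∧
      ∀ t > 0, ∀ w, HasDerivAt x w t → (x t, x t, -w) ∈ Γ := by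
  obtain ⟨B, hB0, hB⟩ : ∃ B : ℝ, 0 ≤ B ∧ ∀ p ∈ Γ, ‖p.2.2‖ ≤ B := by
    obtain ⟨B, hB⟩ := hΓ.isBounded.exists_norm_le
    refine ⟨max B 0, le_max_right _ _, fun p hp => le_max_of_le_left ?_⟩
    exact ((norm_snd_le p.2).trans (norm_snd_le p)).trans (hB p hp)
  set α : ℕ → ℝ := fun n => ((n : ℝ) + 1)⁻¹ with hα
  have hαpos : ∀ n, 0 < α n := fun n => by positivity
  choose! q hqC w hwΓ hqw using hstep
  let X : ℕ → ℕ → E := fun n k => (q (α n))^[k] x₀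
  have hXC : ∀ n k, X n k ∈ C := by
    intro n k
    induction k with
    | zero => exact hx₀
    | succ k ih =>
      simp only [X, Function.iterate_succ_apply']
      exact hqC _ (hαpos n) _ ih
  have hXs : ∀ n k, X n (k + 1) = q (α n) (X n k) := fun n k =>
    Function.iterate_succ_apply' _ _ _
  have hXd : ∀ n k, X n (k + 1) - X n k = -(α n • w (α n) (X n k)) := fun n k => by
    rw [hXs, hqw _ (hαpos n) _ (hXC n k)]; abel
  have hXΓ : ∀ n k, (X n k, X n (k + 1), w (α n) (X n k)) ∈ Γ := fun n k => by
    rw [hXs]; exact hwΓ _ (hαpos n) _ (hXC n k)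
  have hXb : ∀ n k, ‖X n (k + 1) - X n k‖ ≤ α n * B := fun n k => by
    rw [hXd, norm_neg, norm_smul, Real.norm_of_nonneg (hαpos n).le]
    exact mul_le_mul_of_nonneg_left (hB _ (hXΓ n k)) (hαpos n).le
  let J : ℕ → ℝ → ℕ := fun n t => ⌊max t 0 * ((n : ℝ) + 1)⌋₊
  let U : Ultrafilter ℕ := hyperfilter ℕ
  have hU : (U : Filter ℕ) ≤ atTop := Nat.hyperfilter_le_atTop
  have hJ : ∀ t, Tendsto (fun n => α n * (J n t : ℝ)) U (𝓝 (max t 0)) := fun t =>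
    (tendsto_natFloor_mul_succ_div _ (le_max_right _ _)).mono_left hU
  have hlim : ∀ t, ∃ y ∈ C, Tendsto (fun n => X n (J n t)) U (𝓝 y) := fun t =>
    hC.ultrafilter_le_nhds (U.map fun n => X n (J n t))
      (tendsto_principal.2 (Eventually.of_forall fun n => hXC n _))
  choose x hxC hx using hlim
  refine ⟨⟨B, hB0⟩, x, ?_, ?_, hxC, ?_⟩
  · refine LipschitzWith.of_dist_le_mul fun t s => ?_
    have h1 : dist (x t) (x s) ≤ B * |max t 0 - max s 0| := by
      refine le_of_tendsto_of_tendsto' ((hx t).dist (hx s))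
        (((hJ t).sub (hJ s)).abs.const_mul B) fun n => ?_
      refine (dist_le_mul_of_norm_succ_sub_le (hXb n) _ _).trans (le_of_eq ?_)
      rw [← mul_sub, abs_mul, abs_of_pos (hαpos n)]
      ring
    refine h1.trans ?_
    rw [Real.dist_eq]
    exact mul_le_mul_of_nonneg_left (abs_max_sub_max_le_abs t s 0) hB0
  · refine tendsto_nhds_unique (hx 0) ?_
    refine tendsto_const_nhds.congr fun n => ?_
    simp [J, X]
  · intro t ht w₀ hw₀
    by_contra hcon
    have hclosed : IsClosed {w | (x t, x t, w) ∈ Γ} :=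
      hΓ.isClosed.preimage (by fun_prop : Continuous fun w : E => (x t, x t, w))
    obtain ⟨φ, c, hφ, hc⟩ := geometric_hahn_banach_closed_point (hconv _ (hxC t)) hclosed
      (show -w₀ ∉ {w | (x t, x t, w) ∈ Γ} from hcon)
    obtain ⟨δ, hδ, hnear⟩ := exists_forall_dist_lt_of_fibre_lt hΓ φ.continuous hφ
    have hright : ∀ h : ℝ, 0 < h → B * h < δ / 2 → -c * h ≤ φ (x (t + h)) - φ (x t) := by
      intro h hh hBh
      have hJt := hJ t
      have hJh := hJ (t + h)
      rw [max_eq_left ht.le] at hJt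
      rw [max_eq_left (by linarith)] at hJh
      have hdiff : Tendsto (fun n => α n * (J n (t + h) : ℝ) - α n * (J n t : ℝ)) U (𝓝 h) := by
        simpa using hJh.sub hJt
      have hle : ∀ n, J n t ≤ J n (t + h) := fun n =>
        Nat.floor_mono (mul_le_mul_of_nonneg_right (max_le_max_right _ (by linarith))
          (by positivity))
      have e1 : ∀ᶠ n in (U : Filter ℕ),
          B * (α n * (J n (t + h) : ℝ) - α n * (J n t : ℝ)) < δ / 2 :=
        (hdiff.const_mul B).eventually_lt_const hBh
      have e2 : ∀ᶠ n in (U : Filter ℕ), dist (X n (J n t)) (x t) < δ / 2 :=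
        (hx t).eventually (Metric.ball_mem_nhds _ (by positivity))
      refine le_of_tendsto_of_tendsto (hdiff.const_mul (-c))
        (((φ.continuous.tendsto _).comp (hx (t + h))).sub ((φ.continuous.tendsto _).comp (hx t)))
        ?_
      filter_upwards [e1, e2] with n h1 h2
      have hclose : ∀ k, J n t ≤ k → k ≤ J n (t + h) → dist (X n k) (x t) < δ := by
        intro k hk1 hk2
        have h3 := norm_sub_le_mul_of_norm_succ_sub_le (hXb n) hk1
        have h4 : (k : ℝ) ≤ J n (t + h) := by exact_mod_cast hk2
        have h5 : α n * B * ((k : ℝ) - J n t) ≤ α n * B * ((J n (t + h) : ℝ) - J n t) :=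
          mul_le_mul_of_nonneg_left (by linarith) (mul_nonneg (hαpos n).le hB0)
        calc dist (X n k) (x t) ≤ dist (X n k) (X n (J n t)) + dist (X n (J n t)) (x t) :=
              dist_triangle _ _ _
          _ < δ := by rw [dist_eq_norm (X n k)]; nlinarith
      have h6 := mul_le_sub_of_le_succ_sub (a := fun k => φ (X n k)) (c := -c * α n) (hle n) (by
        intro k hk1 hk2
        have h7 := hnear _ _ _ (hXΓ n k) (hclose k hk1 hk2.le) (hclose (k + 1) (by omega) hk2)
        rw [← map_sub, hXd, map_neg, map_smul, smul_eq_mul]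
        nlinarith [hαpos n])
      simp only [Function.comp_apply]
      linarith
    have hd : HasDerivAt (fun r => φ (x r)) (φ w₀) t := φ.hasFDerivAt.comp_hasDerivAt t hw₀
    have hs := (hasDerivAt_iff_tendsto_slope_zero.1 hd).mono_left (nhdsGT_le_nhdsNE 0)
    have hge : -c ≤ φ w₀ := by
      refine ge_of_tendsto hs ?_
      have hmem : ∀ᶠ h in 𝓝[>] (0 : ℝ), B * h < δ / 2 := by
        have : Tendsto (fun h : ℝ => B * h) (𝓝 0) (𝓝 (B * 0)) :=
          (continuous_const.mul continuous_id).tendsto 0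
        rw [mul_zero] at this
        exact (this.mono_left nhdsWithin_le_nhds).eventually_lt_const (by positivity)
      filter_upwards [hmem, self_mem_nhdsWithin] with h h1 h2
      have h3 := hright h h2 h1
      rw [smul_eq_mul, ← div_eq_inv_mul, le_div_iff₀ h2]
      exact h3
    rw [map_neg] at hc
    linarith

lemma IsSubgradOn.hasDerivAt_comp {E : Type*} [NormedAddCommGroup E] [InnerProductSpace ℝ E]
    {C : Set E} {G : E → ℝ} {x : ℝ → E} {t : ℝ} {s w : E} (hs : IsSubgradOn C G (x t) s)
    (hxC : ∀ r, x r ∈ C) (hx : HasDerivAt x w t)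
    (hd : DifferentiableAt ℝ (fun r => G (x r)) t) :
    HasDerivAt (fun r => G (x r)) ⟪s, w⟫ t := by
  have h1 : HasDerivAt (fun r => ⟪s, x r⟫) ⟪s, w⟫ t := by
    simpa using (hasDerivAt_const t s).inner ℝ hx
  have h2 := hd.hasDerivAt.sub h1
  have hmin : IsLocalMin ((fun r => G (x r)) - fun r => ⟪s, x r⟫) t :=
    Eventually.of_forall fun r => by
      have := hs (x r) (hxC r)
      rw [inner_sub_right] at this
      simp only [Pi.sub_apply]
      linarith
  have h3 := hmin.hasDerivAt_eq_zero h2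
  rw [sub_eq_zero] at h3
  exact h3 ▸ hd.hasDerivAt

lemma IsSubgradOn.of_inter_closedBall {E : Type*} [NormedAddCommGroup E] [InnerProductSpace ℝ E]
    {S : Set E} {G : E → ℝ} (hG : ConvexOn ℝ S G) {a z s : E} {R : ℝ} (hzS : z ∈ S)
    (hz : z ∈ Metric.ball a R) (hs : IsSubgradOn (S ∩ Metric.closedBall a R) G z s) :
    IsSubgradOn S G z s := by
  intro y hy
  have hcont : Tendsto (fun l : ℝ => z + l • (y - z)) (𝓝[>] 0) (𝓝 z) := by
    have : Continuous fun l : ℝ => z + l • (y - z) := by fun_prop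
    simpa using (this.tendsto 0).mono_left nhdsWithin_le_nhds
  obtain ⟨l, hlb, hl⟩ := ((hcont.eventually (Metric.isOpen_ball.mem_nhds hz)).and
    (Ioc_mem_nhdsGT (zero_lt_one' ℝ))).exists
  have e : z + l • (y - z) = (1 - l) • z + l • y := by module
  have hmem : z + l • (y - z) ∈ S := by
    rw [e]; exact hG.1 hzS hy (by linarith [hl.2]) hl.1.le (by ring)
  have h1 := hs _ ⟨hmem, Metric.ball_subset_closedBall hlb⟩
  have h2 := hG.2 hzS hy (by linarith [hl.2] : 0 ≤ 1 - l) hl.1.le (by ring)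
  rw [← e, smul_eq_mul, smul_eq_mul] at h2
  rw [add_sub_cancel_left, real_inner_smul_right] at h1
  have h3 : l * (G z + ⟪s, y - z⟫) ≤ l * G y := by linarith
  exact le_of_mul_le_mul_left h3 hl.1

lemma convex_setOf_isSubgradOn {E : Type*} [NormedAddCommGroup E] [InnerProductSpace ℝ E]
    (C : Set E) (G : E → ℝ) (x : E) : Convex ℝ {s | IsSubgradOn C G x s} := by
  intro s hs s' hs' a b ha hb hab y hy
  rw [inner_add_left, real_inner_smul_left, real_inner_smul_left]
  have h1 := mul_le_mul_of_nonneg_left (hs y hy) ha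
  have h2 := mul_le_mul_of_nonneg_left (hs' y hy) hb
  have e1 : G x = a * G x + b * G x := by rw [← add_mul, hab, one_mul]
  have e2 : G y = a * G y + b * G y := by rw [← add_mul, hab, one_mul]
  linarith

lemma LipschitzWith.intervalIntegrable_deriv {E : Type*} [NormedAddCommGroup E]
    [InnerProductSpace ℝ E] [FiniteDimensional ℝ E] {B : NNReal} {x : ℝ → E}
    (hx : LipschitzWith B x) (a b : ℝ) : IntervalIntegrable (deriv x) volume a b := by
  have h : IntervalIntegrable (fun _ : ℝ => (B : ℝ)) volume a b := intervalIntegrable_const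
  refine h.mono_fun (stronglyMeasurable_deriv x).aestronglyMeasurable ?_
  filter_upwards with t
  simpa using norm_deriv_le_of_lipschitz hx (x₀ := t)

lemma LipschitzWith.integral_deriv_eq_sub {E : Type*} [NormedAddCommGroup E]
    [InnerProductSpace ℝ E] [FiniteDimensional ℝ E] {B : NNReal} {x : ℝ → E}
    (hx : LipschitzWith B x) (a b : ℝ) : ∫ t in a..b, deriv x t = x b - x a := by
  refine ext_inner_left ℝ fun y => ?_
  have hL : LipschitzWith (‖innerSL ℝ y‖₊ * B) fun t => ⟪y, x t⟫ :=
    (innerSL ℝ y).lipschitz.comp hx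
  have hac := (hL.lipschitzOnWith (s := Set.uIcc a b)).absolutelyContinuousOnInterval
  have h1 := hac.integral_deriv_eq_sub
  have h2 := (innerSL ℝ y).intervalIntegral_comp_comm (hx.intervalIntegrable_deriv a b)
  simp only [innerSL_apply_apply] at h2
  rw [← h2, inner_sub_right, ← h1]
  refine intervalIntegral.integral_congr_ae ?_
  filter_upwards [hx.ae_differentiableAt_real] with t ht _
  have := (hasDerivAt_const t y).inner ℝ ht.hasDerivAt
  simpa using this.deriv.symm

lemma LocBounded.exists_norm_le {d : ℕ} {F : Euc d → Set (Euc d)} (hF : LocBounded F)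
    {C : Set (Euc d)} (hC : IsCompact C) : ∃ M, ∀ y ∈ C, ∀ v ∈ F y, ‖v‖ ≤ M := by
  refine hC.induction_on (p := fun s => ∃ M, ∀ y ∈ s, ∀ v ∈ F y, ‖v‖ ≤ M) ⟨0, by simp⟩ ?_ ?_ ?_
  · rintro s t hst ⟨M, hM⟩
    exact ⟨M, fun y hy => hM y (hst hy)⟩
  · rintro s t ⟨M, hM⟩ ⟨M', hM'⟩
    refine ⟨max M M', ?_⟩
    rintro y (hy | hy) v hv
    · exact le_max_of_le_left (hM y hy v hv)
    · exact le_max_of_le_right (hM' y hy v hv)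
  · intro x _
    obtain ⟨ε, hε, hb⟩ := hF x
    obtain ⟨M, hM⟩ := hb.exists_norm_le
    exact ⟨_, mem_nhdsWithin_of_mem_nhds (Metric.ball_mem_nhds x hε), M,
      fun y hy v hv => hM v (Set.mem_iUnion₂.2 ⟨y, hy, hv⟩)⟩

lemma LocallyLipschitz.finset_sum {ι X : Type*} [PseudoEMetricSpace X] (s : Finset ι)
    {f : ι → X → ℝ} (hf : ∀ i, LocallyLipschitz (f i)) :
    LocallyLipschitz fun x => ∑ i ∈ s, f i x := by
  classical
  induction s using Finset.induction_on with
  | empty => simpa using LocallyLipschitz.const (0 : ℝ)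
  | insert a s ha ih => simpa [Finset.sum_insert ha] using (hf a).add ih
/-- The triples `(y, z, w)` with `w` the sum of an element of `∑ i, D i y` and a subgradient at `z`
of norm at most `L` of `G` plus the indicator of `C`. -/
def stepGraph {d N : ℕ} (D : Fin N → Euc d → Set (Euc d)) (C : Set (Euc d)) (G : Euc d → ℝ)
    (L : ℝ) : Set (Euc d × Euc d × Euc d) :=
  {p | p.1 ∈ C ∧ p.2.1 ∈ C ∧ ∃ v : Fin N → Euc d, (∀ i, v i ∈ D i p.1) ∧
    ∃ s, IsSubgradOn C G p.2.1 s ∧ ‖s‖ ≤ L ∧ p.2.2 = (∑ i, v i) + s}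

lemma isCompact_stepGraph {d N : ℕ} {D : Fin N → Euc d → Set (Euc d)} {C : Set (Euc d)}
    (hC : IsCompact C) {G : Euc d → ℝ} (hG : ContinuousOn G C)
    (hD : ∀ i, IsClosed {p : Euc d × Euc d | p.2 ∈ D i p.1}) {M : ℝ}
    (hM : ∀ i, ∀ y ∈ C, ∀ v ∈ D i y, ‖v‖ ≤ M) (L : ℝ) : IsCompact (stepGraph D C G L) := by
  set Q : Set (Euc d × Euc d × (Fin N → Euc d) × Euc d) :=
    C ×ˢ C ×ˢ (Set.univ.pi fun _ => Metric.closedBall 0 M) ×ˢ Metric.closedBall 0 L with hQ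
  have hQc : IsCompact Q := hC.prod (hC.prod
    ((isCompact_univ_pi fun _ => isCompact_closedBall _ _).prod (isCompact_closedBall _ _)))
  set P : Set (Euc d × Euc d × (Fin N → Euc d) × Euc d) :=
    Q ∩ ((⋂ i, {p | p.2.2.1 i ∈ D i p.1}) ∩
      ⋂ y ∈ C, {p ∈ Q | G p.2.1 + ⟪p.2.2.2, y - p.2.1⟫ ≤ G y}) with hP
  have hPc : IsCompact P := by
    refine hQc.inter_right (IsClosed.inter (isClosed_iInter fun i => ?_)
      (isClosed_biInter fun y _ => ?_))
    · exact (hD i).preimage (f := fun p : Euc d × Euc d × (Fin N → Euc d) × Euc d =>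
        (p.1, p.2.2.1 i)) (by fun_prop)
    · refine hQc.isClosed.isClosed_le (ContinuousOn.add ?_ ?_) continuousOn_const
      · exact hG.comp (f := fun p : Euc d × Euc d × (Fin N → Euc d) × Euc d => p.2.1)
          (by fun_prop) fun p hp => hp.2.1
      · exact Continuous.continuousOn (by fun_prop)
  have himg : stepGraph D C G L = (fun p : Euc d × Euc d × (Fin N → Euc d) × Euc d =>
      (p.1, p.2.1, (∑ i, p.2.2.1 i) + p.2.2.2)) '' P := by
    ext ⟨y, z, w⟩
    constructor
    · rintro ⟨hy, hz, v, hv, s, hs, hsL, hw⟩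
      have hmem : (y, z, v, s) ∈ Q :=
        ⟨hy, hz, fun i _ => by simpa using hM i y hy _ (hv i), by simpa using hsL⟩
      refine ⟨(y, z, v, s), ⟨hmem, Set.mem_iInter.2 hv,
        Set.mem_iInter₂.2 fun y' hy' => ⟨hmem, hs y' hy'⟩⟩, ?_⟩
      simp only at hw
      rw [hw]
    · rintro ⟨⟨y', z', v, s⟩, ⟨hq, hv, hs⟩, he⟩
      simp only [Prod.mk.injEq] at he
      obtain ⟨rfl, rfl, rfl⟩ := he
      exact ⟨hq.1, hq.2.1, v, Set.mem_iInter.1 hv, s,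
        fun y hy => (Set.mem_iInter₂.1 hs y hy).2, by simpa using hq.2.2.2, rfl⟩
  rw [himg]
  exact hPc.image (by fun_prop)

lemma convex_fibre_stepGraph {d N : ℕ} {D : Fin N → Euc d → Set (Euc d)}
    (hD : ∀ i x, Convex ℝ (D i x)) (C : Set (Euc d)) (G : Euc d → ℝ) (L : ℝ) (x : Euc d) :
    Convex ℝ {w | (x, x, w) ∈ stepGraph D C G L} := by
  rintro w ⟨hx, -, v, hv, s, hs, hsL, hw⟩ w' ⟨-, -, v', hv', s', hs', hsL', hw'⟩ a b ha hb hab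
  refine ⟨hx, hx, a • v + b • v', fun i => hD i x (hv i) (hv' i) ha hb hab, a • s + b • s',
    convex_setOf_isSubgradOn C G x hs hs' ha hb hab, ?_, ?_⟩
  · have := convex_closedBall (0 : Euc d) L (mem_closedBall_zero_iff.2 hsL)
      (mem_closedBall_zero_iff.2 hsL') ha hb hab
    simpa using this
  · simp only at hw hw' ⊢
    rw [hw, hw']
    simp only [Pi.add_apply, Pi.smul_apply, Finset.sum_add_distrib, ← Finset.smul_sum]
    module

/-- Lipschitz solutions of the differential inclusion restricted to a compact convex set `C`. -/
theorem exists_lipschitz_solution_on_compact {d N : ℕ} {D : Fin N → Euc d → Set (Euc d)}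
    (hD : ∀ i, IsClosed {p : Euc d × Euc d | p.2 ∈ D i p.1}) (hb : ∀ i, LocBounded (D i))
    (hne : ∀ i x, (D i x).Nonempty) (hcv : ∀ i x, Convex ℝ (D i x))
    {C : Set (Euc d)} (hC : IsCompact C) {G : Euc d → ℝ} (hG : ConvexOn ℝ C G)
    (hGl : LocallyLipschitzOn C G) {x₀ : Euc d} (hx₀ : x₀ ∈ C) :
    ∃ (B : NNReal) (x : ℝ → Euc d), LipschitzWith B x ∧ x 0 = x₀ ∧ (∀ t, x t ∈ C) ∧
      ∀ t > 0, ∀ w, HasDerivAt x w t → ∃ v : Fin N → Euc d, (∀ i, v i ∈ D i (x t)) ∧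
        ∃ s, IsSubgradOn C G (x t) s ∧ -w = (∑ i, v i) + s := by
  obtain ⟨K, hK⟩ := hGl.exists_lipschitzOnWith_of_compact hC
  choose M₀ hM₀ using fun i => (hb i).exists_norm_le hC
  obtain ⟨M, hM⟩ : ∃ M, ∀ i, M₀ i ≤ M := by
    obtain ⟨M, hM⟩ := (Set.finite_range M₀).bddAbove
    exact ⟨M, fun i => hM ⟨i, rfl⟩⟩
  have hM' : ∀ i, ∀ y ∈ C, ∀ v ∈ D i y, ‖v‖ ≤ M := fun i y hy v hv =>
    (hM₀ i y hy v hv).trans (hM i)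
  set L : ℝ := K + 2 * (N * M)
  obtain ⟨B, x, hB, h0, hxC, hd⟩ := exists_lipschitz_solution_of_steps hC
    (isCompact_stepGraph hC hK.continuousOn hD hM' L)
    (fun y _ => convex_fibre_stepGraph hcv C G L y) (fun α hα p hp => by
      choose v hv using fun i => hne i p
      have hvM : ‖∑ i, v i‖ ≤ N * M := by
        refine (norm_sum_le_of_le _ fun i _ => hM' i p hp _ (hv i)).trans ?_
        simp
      obtain ⟨q, hq, s, hs, hsL, -, hqs⟩ := exists_prox_step hC hG K.2
        (fun y hy z hz => by
          simpa [Real.dist_eq, dist_eq_norm] using hK.dist_le_mul y hy z hz) hp hvM hα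
      exact ⟨q, hq, _, ⟨hp, hq, v, hv, s, hs, hsL, rfl⟩, hqs⟩) hx₀
  refine ⟨B, x, hB, h0, hxC, fun t ht w hw => ?_⟩
  obtain ⟨-, -, v, hv, s, hs, -, he⟩ := hd t ht w hw
  exact ⟨v, hv, s, hs, he⟩

/-- `(x, u)` is a solution on `[0, 1]`, with derivative `u`, of `-x' ∈ F x` staying in `S`. -/
structure IsUnitSolution {d : ℕ} (F : Euc d → Set (Euc d)) (S : Set (Euc d))
    (x u : ℝ → Euc d) : Prop where
  intervalIntegrable : IntervalIntegrable u volume 0 1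
  eq_add_integral : ∀ t ∈ Set.Icc (0 : ℝ) 1, x t = x 0 + ∫ s in (0 : ℝ)..t, u s
  mem : ∀ t ∈ Set.Icc (0 : ℝ) 1, x t ∈ S
  ae_mem : ∀ᵐ t ∂volume, t ∈ Set.Ioo (0 : ℝ) 1 → -u t ∈ F (x t)

/-- The kinetic energy of a Lipschitz curve along which `h` decreases at rate `‖x'‖²` bounds its
displacement. -/
lemma norm_sub_le_of_energy {d : ℕ} {B B' : NNReal} {x : ℝ → Euc d} {h : ℝ → ℝ}
    (hx : LipschitzWith B x) (hh : LipschitzWith B' h)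
    (hd : ∀ᵐ t ∂volume, t ∈ Set.Ioo (0 : ℝ) 1 → HasDerivAt h (-‖deriv x t‖ ^ 2) t)
    {t : ℝ} (ht : t ∈ Set.Icc (0 : ℝ) 1) : ‖x t - x 0‖ ≤ (1 + (h 0 - h t)) / 2 := by
  have hi := hh.intervalIntegrable_deriv 0 t
  rw [← hx.integral_deriv_eq_sub 0 t]
  have h1 : ‖∫ r in (0 : ℝ)..t, deriv x r‖ ≤ ∫ r in (0 : ℝ)..t, (1 - deriv h r) / 2 := by
    refine intervalIntegral.norm_integral_le_of_norm_le ht.1 ?_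
      ((intervalIntegrable_const.sub hi).div_const 2)
    filter_upwards [hd, Measure.ae_ne volume (1 : ℝ)] with r hr hr1 hrt
    rw [(hr ⟨hrt.1, lt_of_le_of_ne (hrt.2.trans ht.2) hr1⟩).deriv]
    nlinarith [sq_nonneg (‖deriv x r‖ - 1)]
  rw [intervalIntegral.integral_div, intervalIntegral.integral_sub intervalIntegrable_const hi,
    hh.integral_deriv_eq_sub, intervalIntegral.integral_const, smul_eq_mul] at h1
  linarith [ht.2]

theorem exists_isUnitSolution {d N : ℕ} {f : Fin N → Euc d → ℝ}
    {D : Fin N → Euc d → Set (Euc d)} (hf : ∀ i, LocallyLipschitz (f i))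
    (hD : ∀ i, IsConservativeFieldR (D i) (f i)) (hb : ∀ i, LocBounded (D i))
    (hne : ∀ i x, (D i x).Nonempty) (hcv : ∀ i x, Convex ℝ (D i x))
    {S : Set (Euc d)} (hS : IsClosed S) {G : Euc d → ℝ} (hG : ConvexOn ℝ S G)
    (hGl : LocallyLipschitzOn S G) {c : ℝ} (hc : ∀ x ∈ S, c ≤ (∑ i, f i x) + G x)
    {x₀ : Euc d} (hx₀ : x₀ ∈ S) :
    ∃ x u : ℝ → Euc d, x 0 = x₀ ∧ IsUnitSolution (fun z => {w | ∃ v : Fin N → Euc d,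
      (∀ i, v i ∈ D i z) ∧ ∃ s, IsSubgradOn S G z s ∧ w = (∑ i, v i) + s}) S x u := by
  set e : ℝ := (∑ i, f i x₀) + G x₀ - c with he
  have he0 : 0 ≤ e := sub_nonneg.2 (hc x₀ hx₀)
  set C := S ∩ Metric.closedBall x₀ ((1 + e) / 2 + 1) with hCdef
  have hC : IsCompact C := (isCompact_closedBall _ _).inter_left hS
  have hGC : ConvexOn ℝ C G :=
    hG.subset Set.inter_subset_left (hG.1.inter (convex_closedBall _ _))
  have hGlC : LocallyLipschitzOn C G := hGl.mono Set.inter_subset_left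
  obtain ⟨B, x, hB, h0, hxC, hd⟩ := exists_lipschitz_solution_on_compact (fun i => (hD i).1) hb
    hne hcv hC hGC hGlC (x₀ := x₀) ⟨hx₀, Metric.mem_closedBall_self (by linarith)⟩
  obtain ⟨Kf, hKf⟩ := ((LocallyLipschitz.finset_sum Finset.univ hf).locallyLipschitzOn
    (s := C)).exists_lipschitzOnWith_of_compact hC
  obtain ⟨Kg, hKg⟩ := hGlC.exists_lipschitzOnWith_of_compact hC
  have hLf : LipschitzWith (Kf * B) fun t => ∑ i, f i (x t) :=
    lipschitzOnWith_univ.1 (hKf.comp hB.lipschitzOnWith fun t _ => hxC t)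
  have hLg : LipschitzWith (Kg * B) fun t => G (x t) :=
    lipschitzOnWith_univ.1 (hKg.comp hB.lipschitzOnWith fun t _ => hxC t)
  have hint : ∀ t, x t = x 0 + ∫ s in (0 : ℝ)..t, deriv x s := fun t => by
    rw [hB.integral_deriv_eq_sub]; abel
  have hcons : ∀ᵐ t ∂volume, ∀ i, t ∈ Set.Ioo (0 : ℝ) 1 →
      ∀ v ∈ D i (x t), HasDerivAt (fun s => f i (x s)) ⟪v, deriv x t⟫ t :=
    ae_all_iff.2 fun i => (hD i).2 x (deriv x) (hB.intervalIntegrable_deriv 0 1)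
      (fun t _ => hint t) fun t _ => hne i _
  have henergy : ∀ᵐ t ∂volume, t ∈ Set.Ioo (0 : ℝ) 1 →
      HasDerivAt (fun r => (∑ i, f i (x r)) + G (x r)) (-‖deriv x t‖ ^ 2) t := by
    filter_upwards [hcons, hB.ae_differentiableAt_real, hLg.ae_differentiableAt_real]
      with t h1 h2 h3 ht
    obtain ⟨v, hv, s, hs, hvs⟩ := hd t ht.1 _ h2.hasDerivAt
    have h4 := HasDerivAt.fun_sum (u := Finset.univ) fun i _ => h1 i ht _ (hv i)
    convert! h4.add (hs.hasDerivAt_comp hxC h2.hasDerivAt h3) using 1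
    rw [← sum_inner, ← inner_add_left, ← hvs, inner_neg_left, real_inner_self_eq_norm_sq]
  have hball : ∀ t ∈ Set.Icc (0 : ℝ) 1, x t ∈ Metric.ball x₀ ((1 + e) / 2 + 1) := by
    intro t ht
    have h1 := norm_sub_le_of_energy hB (hLf.add hLg) henergy ht
    have h2 := hc (x t) (hxC t).1
    rw [h0] at h1
    rw [mem_ball_iff_norm]
    linarith
  refine ⟨x, deriv x, h0, hB.intervalIntegrable_deriv 0 1, fun t _ => hint t,
    fun t _ => (hxC t).1, ?_⟩
  filter_upwards [hB.ae_differentiableAt_real] with t h2 ht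
  obtain ⟨v, hv, s, hs, hvs⟩ := hd t ht.1 _ h2.hasDerivAt
  exact ⟨v, hv, s, hs.of_inter_closedBall hG (hxC t).1 (hball t ⟨ht.1.le, ht.2.le⟩), hvs⟩
/-- Unit-time solvability from every point of `S` gives global solvability by concatenation. -/
theorem exists_global_solution_of_unit {d : ℕ} {F : Euc d → Set (Euc d)} {S : Set (Euc d)}
    (hunit : ∀ p ∈ S, ∃ x u : ℝ → Euc d, x 0 = p ∧ IsUnitSolution F S x u)
    {x₀ : Euc d} (hx₀ : x₀ ∈ S) :
    ∃ x u : ℝ → Euc d, (∀ T ≥ (0 : ℝ), IntervalIntegrable u volume 0 T) ∧ x 0 = x₀ ∧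
      (∀ t ≥ (0 : ℝ), x t = x 0 + ∫ s in (0 : ℝ)..t, u s) ∧ (∀ t ≥ (0 : ℝ), x t ∈ S) ∧
      ∀ᵐ t ∂volume, 0 < t → -u t ∈ F (x t) := by
  choose X U hX0 hXU using fun p : S => hunit p p.2
  let next : S → S := fun p => ⟨X p 1, (hXU p).mem 1 (by simp)⟩
  let y : ℕ → ℝ → Euc d := fun n => X (next^[n] ⟨x₀, hx₀⟩)
  let v : ℕ → ℝ → Euc d := fun n => U (next^[n] ⟨x₀, hx₀⟩)
  have hyv : ∀ n, IsUnitSolution F S (y n) (v n) := fun n => hXU _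
  have hy1 : ∀ n, y (n + 1) 0 = y n 1 := fun n => by
    simp only [y, Function.iterate_succ_apply', hX0, next]
  let x : ℝ → Euc d := fun t => y ⌊t⌋₊ (t - ⌊t⌋₊)
  let u : ℝ → Euc d := fun t => v ⌊t⌋₊ (t - ⌊t⌋₊)
  have hfloor : ∀ (n : ℕ) (r : ℝ), r ∈ Set.Ico (0 : ℝ) 1 → ⌊(n : ℝ) + r⌋₊ = n := fun n r hr =>
    (Nat.floor_eq_iff (by have := hr.1; positivity)).2 ⟨by linarith [hr.1], by linarith [hr.2]⟩
  have hu : ∀ (n : ℕ) (r : ℝ), r ∈ Set.Ico (0 : ℝ) 1 → u (n + r) = v n r := fun n r hr => by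
    simp only [u, hfloor n r hr, add_sub_cancel_left]
  have hx : ∀ (n : ℕ) (r : ℝ), r ∈ Set.Icc (0 : ℝ) 1 → x (n + r) = y n r := fun n r hr => by
    rcases hr.2.lt_or_eq with h | rfl
    · simp only [x, hfloor n r ⟨hr.1, h⟩, add_sub_cancel_left]
    · have := hfloor (n + 1) 0 (by simp)
      push_cast at this
      rw [add_zero] at this
      simp only [x, this]
      push_cast
      rw [sub_self, hy1]
  have hxn : ∀ n : ℕ, x n = y n 0 := fun n => by simpa using hx n 0 (by simp)
  have hdecomp : ∀ t ≥ (0 : ℝ), ∃ (n : ℕ), ∃ r ∈ Set.Ico (0 : ℝ) 1, t = n + r := fun t ht =>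
    ⟨⌊t⌋₊, t - ⌊t⌋₊, ⟨sub_nonneg.2 (Nat.floor_le ht), by linarith [Nat.lt_floor_add_one t]⟩,
      by ring⟩
  have hshift : ∀ (n : ℕ), ∀ r ∈ Set.Icc (0 : ℝ) 1,
      IntervalIntegrable u volume n (n + r) ∧ x (n + r) = x n + ∫ s in (n : ℝ)..(n + r), u s := by
    intro n r hr
    have heq : Set.EqOn (fun s => v n (s - n)) u (Set.uIoo (n : ℝ) (n + r)) := by
      intro s hs
      rw [Set.uIoo_of_le (by linarith [hr.1])] at hs
      have := hu n (s - n) ⟨by linarith [hs.1], by linarith [hs.2, hr.2]⟩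
      rw [add_sub_cancel] at this
      exact this.symm
    have hi : IntervalIntegrable (v n) volume 0 r :=
      (hyv n).intervalIntegrable.mono_set (by
        rw [Set.uIcc_of_le hr.1, Set.uIcc_of_le zero_le_one]
        exact Set.Icc_subset_Icc_right hr.2)
    have hi' := hi.comp_sub_right (n : ℝ)
    rw [zero_add, add_comm r] at hi'
    refine ⟨hi'.congr_uIoo heq, ?_⟩
    rw [← intervalIntegral.integral_congr_uIoo heq, intervalIntegral.integral_comp_sub_right,
      hx n r hr, hxn, sub_self, add_sub_cancel_left]
    exact (hyv n).eq_add_integral r hr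
  have hnat : ∀ n : ℕ, IntervalIntegrable u volume 0 n ∧ x n = x 0 + ∫ s in (0 : ℝ)..n, u s := by
    intro n
    induction n with
    | zero => simp
    | succ n ih =>
      obtain ⟨h1, h2⟩ := hshift n 1 (by simp)
      push_cast
      refine ⟨ih.1.trans h1, ?_⟩
      rw [h2, ih.2, add_assoc, intervalIntegral.integral_add_adjacent_intervals ih.1 h1]
  refine ⟨x, u, fun T hT => ?_, ?_, fun t ht => ?_, fun t ht => ?_, ?_⟩
  · obtain ⟨n, r, hr, rfl⟩ := hdecomp T hT
    exact (hnat n).1.trans (hshift n r ⟨hr.1, hr.2.le⟩).1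
  · have := hxn 0
    rw [Nat.cast_zero] at this
    rw [this]
    exact hX0 _
  · obtain ⟨n, r, hr, rfl⟩ := hdecomp t ht
    obtain ⟨h1, h2⟩ := hshift n r ⟨hr.1, hr.2.le⟩
    rw [h2, (hnat n).2, add_assoc, intervalIntegral.integral_add_adjacent_intervals (hnat n).1 h1]
  · obtain ⟨n, r, hr, rfl⟩ := hdecomp t ht
    rw [hx n r ⟨hr.1, hr.2.le⟩]
    exact (hyv n).mem r ⟨hr.1, hr.2.le⟩
  · have h1 : ∀ᵐ t : ℝ ∂volume, ∀ n : ℕ, t - n ∈ Set.Ioo (0 : ℝ) 1 →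
        -v n (t - n) ∈ F (y n (t - n)) :=
      ae_all_iff.2 fun n =>
        (measurePreserving_sub_right volume (n : ℝ)).quasiMeasurePreserving.ae (hyv n).ae_mem
    have h2 : ∀ᵐ t : ℝ ∂volume, ∀ n : ℕ, t ≠ n := ae_all_iff.2 fun n => Measure.ae_ne volume _
    filter_upwards [h1, h2] with t ht1 ht2 ht0
    obtain ⟨n, r, hr, rfl⟩ := hdecomp t ht0.le
    have hr0 : r ≠ 0 := fun h => ht2 n (by rw [h, add_zero])
    have h3 := ht1 n
    rw [add_sub_cancel_left] at h3
    rw [hu n r hr, hx n r ⟨hr.1, hr.2.le⟩]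
    exact h3 ⟨lt_of_le_of_ne hr.1 hr0.symm, hr.2⟩

lemma ProperFn.coe_toReal {d : ℕ} {g : Euc d → EReal} (hg : ProperFn g) {x : Euc d}
    (hx : g x ≠ ⊤) : ((g x).toReal : EReal) = g x :=
  EReal.coe_toReal hx (hg.2 x)

lemma ConvexFn.convexOn_toReal {d : ℕ} {g : Euc d → EReal} (hp : ProperFn g) (hg : ConvexFn g) :
    ConvexOn ℝ {x | g x ≠ ⊤} fun x => (g x).toReal := by
  have key : ∀ ⦃x⦄, g x ≠ ⊤ → ∀ ⦃y⦄, g y ≠ ⊤ → ∀ ⦃a b : ℝ⦄, 0 ≤ a → 0 ≤ b → a + b = 1 →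
      g (a • x + b • y) ≤ ((a • (g x).toReal + b • (g y).toReal : ℝ) : EReal) :=
    fun x hx y hy a b ha hb hab =>
      hg (x := (x, (g x).toReal)) (hp.coe_toReal hx).ge (y := (y, (g y).toReal))
        (hp.coe_toReal hy).ge ha hb hab
  refine ⟨fun x hx y hy a b ha hb hab => ?_, fun x hx y hy a b ha hb hab => ?_⟩
  · exact ne_top_of_le_ne_top (EReal.coe_ne_top _) (key hx hy ha hb hab)
  · have h := key hx hy ha hb hab
    rw [← hp.coe_toReal (ne_top_of_le_ne_top (EReal.coe_ne_top _) h)] at h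
    exact EReal.coe_le_coe_iff.1 h

lemma LocLipOnDom.locallyLipschitzOn_toReal {d : ℕ} {g : Euc d → EReal} (hg : LocLipOnDom g) :
    LocallyLipschitzOn {x | g x ≠ ⊤} fun x => (g x).toReal := by
  intro x hx
  obtain ⟨ε, hε, K, hK⟩ := hg x hx
  refine ⟨K.toNNReal, {x | g x ≠ ⊤} ∩ Metric.closedBall x ε,
    Filter.inter_mem self_mem_nhdsWithin
      (mem_nhdsWithin_of_mem_nhds (Metric.closedBall_mem_nhds x hε)),
    LipschitzOnWith.of_dist_le_mul fun y hy z hz => ?_⟩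
  rw [Real.dist_eq, dist_eq_norm]
  refine (hK y hy.1 z hz.1 (mem_closedBall_iff_norm.1 hy.2)
    (mem_closedBall_iff_norm.1 hz.2)).trans ?_
  gcongr
  exact Real.le_coe_toNNReal K

lemma IsSubgradOn.mem_subdiff {d : ℕ} {g : Euc d → EReal} (hp : ProperFn g) {x s : Euc d}
    (hx : g x ≠ ⊤) (hs : IsSubgradOn {x | g x ≠ ⊤} (fun x => (g x).toReal) x s) :
    s ∈ Subdiff g x := by
  intro y
  by_cases hy : g y = ⊤
  · rw [hy]; exact le_top
  · rw [← hp.coe_toReal hx, ← hp.coe_toReal hy]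
    exact_mod_cast hs y hy

/-- under the standing assumptions, from every initial point of
`dom Φ` there exists a global solution on `[0,∞)` of the differential inclusion
`x' ∈ −D_Φ(x)` staying in `dom Φ`. -/
theorem stmt9 {d N : ℕ} (hN : 1 ≤ N) (f : Fin N → Euc d → ℝ)
    (D : Fin N → Euc d → Set (Euc d)) (g : Euc d → EReal)
    (hSA : StandingAssumptions N f D g)
    (x₀ : Euc d) (hx₀ : Phi N f g x₀ ≠ ⊤) :
    ∃ x u : ℝ → Euc d,
      (∀ T ≥ (0:ℝ), IntervalIntegrable u volume 0 T) ∧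
      x 0 = x₀ ∧
      (∀ t ≥ (0:ℝ), x t = x 0 + ∫ s in (0:ℝ)..t, u s) ∧
      (∀ t ≥ (0:ℝ), Phi N f g (x t) ≠ ⊤) ∧
      (∀ᵐ t ∂volume, 0 < t → -u t ∈ DPhi N D g (x t)) := by
  obtain ⟨hf, hD, hb, hncv, hp, hcv, hcl, hlip, c, hc⟩ := hSA
  have hdom : ∀ x, Phi N f g x ≠ ⊤ ↔ x ∈ {x | g x ≠ ⊤} := fun x => by
    simp only [Phi, Set.mem_ofPred_eq]
    refine not_congr ⟨fun h => ?_, fun h => by rw [h, EReal.coe_add_top]⟩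
    by_contra hgx
    rw [← hp.coe_toReal hgx, ← EReal.coe_add] at h
    exact EReal.coe_ne_top _ h
  obtain ⟨x, u, h1, h2, h3, h4, h5⟩ := exists_global_solution_of_unit (fun p hpS =>
    exists_isUnitSolution hf hD hb (fun i x => (hncv i x).1) (fun i x => (hncv i x).2) hcl
      (hcv.convexOn_toReal hp) hlip.locallyLipschitzOn_toReal (c := c) (fun x hx => by
        have h := hc x
        rw [Phi, ← hp.coe_toReal hx] at h
        exact_mod_cast h) hpS) ((hdom x₀).1 hx₀)
  refine ⟨x, u, h1, h2, h3, fun t ht => (hdom _).2 (h4 t ht), ?_⟩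
  filter_upwards [h5] with t ht ht0
  obtain ⟨v, hv, s, hs, he⟩ := ht ht0
  exact ⟨v, hv, s, hs.mem_subdiff hp (h4 t ht0.le), he⟩
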